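/- For all real numbers x, y > 0 and every β in the open interval (0, 1/2), the following refined arithmetic–geometric–harmonic mean inequality holds: 2xy/(x+y) ≤ sqrt(xy) ≤ (1/2)·(x^β·y^(1−β) + x^(1−β)·y^β) ≤ (x+y)/2. -/

import Mathlib

/-- Refined arithmetic–geometric–harmonic mean inequality. -/
theorem refined_agh_inequality (x y β : ℝ) (hx : 0 < x) (hy : 0 < y)
    (hβ0 : 0 < β) (hβ : β < 1 / 2) :
    2 * x * y / (x + y) ≤ Real.sqrt (x * y) ∧
    Real.sqrt (x * y) ≤ (1 / 2) * (x ^ β * y ^ (1 - β) + x ^ (1 - β) * y ^ β) ∧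
    (1 / 2) * (x ^ β * y ^ (1 - β) + x ^ (1 - β) * y ^ β) ≤ (x + y) / 2 := by
  have hprod : (x ^ β * y ^ (1 - β)) * (x ^ (1 - β) * y ^ β) = x * y := by
    have hx1 : x ^ β * x ^ (1 - β) = x := by
      rw [← Real.rpow_add hx, add_sub_cancel, Real.rpow_one]
    have hy1 : y ^ β * y ^ (1 - β) = y := by
      rw [← Real.rpow_add hy, add_sub_cancel, Real.rpow_one]
    calc (x ^ β * y ^ (1 - β)) * (x ^ (1 - β) * y ^ β)
        = (x ^ β * x ^ (1 - β)) * (y ^ β * y ^ (1 - β)) := by ring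
      _ = x * y := by rw [hx1, hy1]
  refine ⟨?_, ?_, ?_⟩
  · apply Real.le_sqrt_of_sq_le
    rw [div_pow, div_le_iff₀ (by positivity)]
    nlinarith [mul_nonneg (mul_pos hx hy).le (sq_nonneg (x - y))]
  · rw [Real.sqrt_le_left (by positivity), ← hprod]
    nlinarith [sq_nonneg (x ^ β * y ^ (1 - β) - x ^ (1 - β) * y ^ β)]
  · have h1 := Real.geom_mean_le_arith_mean2_weighted hβ0.le (by linarith : 0 ≤ 1 - β)
      hx.le hy.le (by ring)
    have h2 := Real.geom_mean_le_arith_mean2_weighted (by linarith : 0 ≤ 1 - β) hβ0.le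
      hx.le hy.le (by ring)
    linarith
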